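/- arXiv:1206.4839 — 2 statements merged into one kernel-verified Lean document; each statement's English description precedes it below -/
import Mathlib

section
/- Let X and E be finite-dimensional real normed spaces and f : S_X → S_E a bijective isometry, let y ∈ S_X, and let T be a linear map representing the tangent action of f at y. Let (x_n) be a sequence in W_y with x_n → −y such that γ((x_n − y)/‖x_n − y‖) converges to some y* ∈ ℷ(−y). Then the limit e* := lim_n γ((f(x_n) − f(y))/‖f(x_n) − f(y)‖) exists, and ⟨y*, u⟩ = ⟨e*, T(u)⟩ for every u ∈ Λ_y. -/
open Filter Topology Metric Set MeasureTheory

noncomputable section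

/-- The normalized direction `v / ‖v‖` of a vector (equal to `0` when `v = 0`). -/
def unitDir {X : Type*} [NormedAddCommGroup X] [NormedSpace ℝ X] (v : X) : X := ‖v‖⁻¹ • v

/-- The set `ℷ(x)` of support functionals at a point `x` of the unit sphere:
functionals of norm one attaining the value `1` at `x`. -/
def suppFn (X : Type*) [NormedAddCommGroup X] [NormedSpace ℝ X] (x : X) :
    Set (X →L[ℝ] ℝ) := {g | ‖g‖ = 1 ∧ g x = 1}

/-- A point of the unit sphere is smooth if it has exactly one support functional. -/
def IsSmoothPt {X : Type*} [NormedAddCommGroup X] [NormedSpace ℝ X] (x : X) : Prop :=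
  ∃ g : X →L[ℝ] ℝ, suppFn X x = {g}

/-- `D_y = {x ∈ S_X : ‖x + y‖ < 2}`. -/
def Dset {X : Type*} [NormedAddCommGroup X] [NormedSpace ℝ X] (y : X) : Set X :=
  {x | x ∈ sphere (0 : X) 1 ∧ ‖x + y‖ < 2}

/-- `W_y`: points `x ∈ D_y` with `(x-y)/‖x-y‖` smooth in `X` and
`(f x - f y)/‖f x - f y‖` smooth in `E`. -/
def Wset {X E : Type*} [NormedAddCommGroup X] [NormedSpace ℝ X]
    [NormedAddCommGroup E] [NormedSpace ℝ E] (f : X → E) (y : X) : Set X :=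
  {x | x ∈ Dset y ∧ IsSmoothPt (unitDir (x - y)) ∧ IsSmoothPt (unitDir (f x - f y))}

/-- `Λ_y`: the set of limit points of `(y - z)/‖y - z‖` as `z → y`, `z ∈ S_X`, `z ≠ y`. -/
def tangentDirs {X : Type*} [NormedAddCommGroup X] [NormedSpace ℝ X] (y : X) : Set X :=
  {u | ∃ z : ℕ → X, (∀ n, z n ∈ sphere (0 : X) 1 ∧ z n ≠ y) ∧
    Tendsto z atTop (𝓝 y) ∧ Tendsto (fun n => unitDir (y - z n)) atTop (𝓝 u)}

/-- A linear map `T` represents the tangent action of `f` at `y`: whenever `y_n → y` on the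
sphere with `(y - y_n)/‖y - y_n‖ → u`, one has `(f y - f y_n)/‖f y - f y_n‖ → T u`. -/
def RepTangent {X E : Type*} [NormedAddCommGroup X] [NormedSpace ℝ X]
    [NormedAddCommGroup E] [NormedSpace ℝ E] (f : X → E) (y : X) (T : X →ₗ[ℝ] E) : Prop :=
  ∀ (z : ℕ → X) (u : X), (∀ n, z n ∈ sphere (0 : X) 1 ∧ z n ≠ y) →
    Tendsto z atTop (𝓝 y) → Tendsto (fun n => unitDir (y - z n)) atTop (𝓝 u) →
    Tendsto (fun n => unitDir (f y - f (z n))) atTop (𝓝 (T u))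

/-- The positively homogeneous extension `F` of `f`: `F 0 = 0`, `F x = ‖x‖ • f (x/‖x‖)`. -/
def homExt {X E : Type*} [NormedAddCommGroup X] [NormedSpace ℝ X]
    [NormedAddCommGroup E] [NormedSpace ℝ E] (f : X → E) (x : X) : E :=
  ‖x‖ • f (unitDir x)

/-- `F` is Gateaux differentiable at `y`: all one-sided directional derivatives exist and
depend linearly (and continuously) on the direction. -/
def GateauxAt {X E : Type*} [NormedAddCommGroup X] [NormedSpace ℝ X]
    [NormedAddCommGroup E] [NormedSpace ℝ E] (F : X → E) (y : X) : Prop :=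
  ∃ L : X →L[ℝ] E, ∀ z : X,
    Tendsto (fun a : ℝ => a⁻¹ • (F (y + a • z) - F y)) (𝓝[>] 0) (𝓝 (L z))

section UnitDir

variable {X : Type*} [NormedAddCommGroup X] [NormedSpace ℝ X]

lemma norm_unitDir {v : X} (hv : v ≠ 0) : ‖unitDir v‖ = 1 := by
  rw [unitDir, norm_smul, norm_inv, norm_norm, inv_mul_cancel₀ (norm_ne_zero_iff.2 hv)]

lemma norm_unitDir_le (v : X) : ‖unitDir v‖ ≤ 1 := by
  by_cases hv : v = 0
  · simp [hv, unitDir]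
  · exact (norm_unitDir hv).le

lemma norm_smul_unitDir (v : X) : ‖v‖ • unitDir v = v := by
  by_cases hv : v = 0
  · simp [hv]
  · rw [unitDir, smul_smul, mul_inv_cancel₀ (norm_ne_zero_iff.2 hv), one_smul]

lemma map_unitDir (g : X →L[ℝ] ℝ) (v : X) : g (unitDir v) = g v / ‖v‖ := by
  rw [unitDir, map_smul, smul_eq_mul, div_eq_inv_mul]

lemma mem_suppFn_unitDir {w : X} (hw : w ≠ 0) {g : X →L[ℝ] ℝ} :
    g ∈ suppFn X (unitDir w) ↔ ‖g‖ ≤ 1 ∧ g w = ‖w‖ := by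
  have hw' : ‖w‖ ≠ 0 := norm_ne_zero_iff.2 hw
  simp only [suppFn, mem_ofPred_eq, map_unitDir, div_eq_one_iff_eq hw']
  refine ⟨fun h => ⟨h.1.le, h.2⟩, fun h => ⟨le_antisymm h.1 ?_, h.2⟩⟩
  have h1 := g.le_opNorm w
  rw [h.2, norm_norm] at h1
  exact le_of_mul_le_mul_right (by simpa using h1) (norm_pos_iff.2 hw)

lemma tendsto_clm_apply {h : ℕ → X →L[ℝ] ℝ} {g : X →L[ℝ] ℝ} {v : ℕ → X} {w : X}
    (hh : Tendsto h atTop (𝓝 g)) (hv : Tendsto v atTop (𝓝 w)) :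
    Tendsto (fun k => h k (v k)) atTop (𝓝 (g w)) :=
  (isBoundedBilinearMap_apply.continuous.tendsto (g, w)).comp (hh.prodMk_nhds hv)

variable [FiniteDimensional ℝ X]

lemma exists_subseq_tendsto_of_norm_le_one {h : ℕ → X} (hh : ∀ k, ‖h k‖ ≤ 1) :
    ∃ a : X, ∃ φ : ℕ → ℕ, StrictMono φ ∧ Tendsto (h ∘ φ) atTop (𝓝 a) := by
  have : ProperSpace X := FiniteDimensional.proper ℝ X
  obtain ⟨a, -, φ, hφ, ha⟩ := (isCompact_closedBall (0 : X) 1).tendsto_subseq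
    (x := h) (fun k => by simpa using hh k)
  exact ⟨a, φ, hφ, ha⟩

/-- Norming functionals of vectors converging to a nonzero vector with a unique support
functional converge to that functional. -/
lemma tendsto_of_norming {w : X} (hw : w ≠ 0) {g : X →L[ℝ] ℝ} (hg : suppFn X (unitDir w) = {g})
    {v : ℕ → X} (hv : Tendsto v atTop (𝓝 w)) {h : ℕ → X →L[ℝ] ℝ} (hh : ∀ k, ‖h k‖ ≤ 1)
    (hhv : ∀ k, h k (v k) = ‖v k‖) : Tendsto h atTop (𝓝 g) := by
  refine tendsto_of_subseq_tendsto fun ns hns => ?_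
  obtain ⟨a, φ, hφ, ha⟩ := exists_subseq_tendsto_of_norm_le_one (h := h ∘ ns) (fun k => hh _)
  refine ⟨φ, ?_⟩
  have hv' : Tendsto (fun k => v (ns (φ k))) atTop (𝓝 w) :=
    hv.comp (hns.comp hφ.tendsto_atTop)
  have h1 : a w = ‖w‖ := by
    refine tendsto_nhds_unique (tendsto_clm_apply ha hv') ?_
    simpa only [Function.comp_apply, hhv] using hv'.norm
  have h2 : ‖a‖ ≤ 1 := le_of_tendsto ha.norm (Eventually.of_forall fun k => hh _)
  have h3 : a ∈ suppFn X (unitDir w) := (mem_suppFn_unitDir hw).2 ⟨h2, h1⟩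
  rw [hg, mem_singleton_iff] at h3
  exact h3 ▸ ha

/-- The norm is differentiable at a nonzero vector with a unique support functional, along
sequences of increments with convergent directions. -/
lemma tendsto_norm_add_sub_div {w : X} (hw : w ≠ 0) {g : X →L[ℝ] ℝ}
    (hg : suppFn X (unitDir w) = {g}) {v : ℕ → X}
    (hv : Tendsto v atTop (𝓝 0)) {u : X}
    (hu : Tendsto (fun k => unitDir (v k)) atTop (𝓝 u)) :
    Tendsto (fun k => (‖w + v k‖ - ‖w‖) / ‖v k‖) atTop (𝓝 (g u)) := by
  choose h hh hhv using fun k => exists_dual_vector'' ℝ (w + v k)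
  have hlim : Tendsto h atTop (𝓝 g) :=
    tendsto_of_norming hw hg (by simpa using hv.const_add w) hh hhv
  obtain ⟨hg1, hgw⟩ := (mem_suppFn_unitDir hw).1 (hg ▸ mem_singleton g)
  refine tendsto_of_tendsto_of_tendsto_of_le_of_le
    ((g.continuous.tendsto u).comp hu) (tendsto_clm_apply hlim hu) (fun k => ?_) (fun k => ?_)
  · have hle : g (w + v k) ≤ ‖w + v k‖ :=
      (le_abs_self _).trans (by simpa using g.le_of_opNorm_le hg1 (w + v k))
    rw [map_add, hgw] at hle
    simp only [Function.comp_apply, map_unitDir]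
    gcongr
    linarith
  · have hle : h k w ≤ ‖w‖ :=
      (le_abs_self _).trans (by simpa using (h k).le_of_opNorm_le (hh k) w)
    have heq := hhv k
    simp only [map_add, RCLike.ofReal_real_eq_id, id_eq] at heq
    simp only [map_unitDir]
    gcongr
    linarith

/-- The tangent directions at a point `e` of the unit sphere span the space together with `e`. -/
lemma eq_zero_of_forall_tangentDirs {e : X} (he : e ∈ sphere (0 : X) 1) {φ : X →L[ℝ] ℝ}
    (hφe : φ e = 0) (hφ : ∀ u ∈ tangentDirs e, φ u = 0) : φ = 0 := by
  by_contra hne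
  obtain ⟨v, hv⟩ : ∃ v, φ v ≠ 0 := by
    by_contra! h
    exact hne (ContinuousLinearMap.ext h)
  have he1 : ‖e‖ = 1 := by simpa using he
  have he0 : e ≠ 0 := norm_ne_zero_iff.1 (by simp [he1])
  let t : ℕ → ℝ := fun k => 1 / ((k : ℝ) + 1)
  have ht : ∀ k, 0 < t k := fun k => by positivity
  have htlim : Tendsto t atTop (𝓝 0) := tendsto_one_div_add_atTop_nhds_zero_nat
  let p : ℕ → X := fun k => e + t k • v
  have hφp : ∀ k, φ (p k) = t k * φ v := fun k => by simp [p, hφe]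
  have hp0 : ∀ k, p k ≠ 0 := fun k h => by
    have := hφp k
    rw [h, map_zero] at this
    exact mul_ne_zero (ht k).ne' hv this.symm
  have hplim : Tendsto p atTop (𝓝 e) := by
    simpa using (htlim.smul_const v).const_add e
  let z : ℕ → X := fun k => unitDir (p k)
  have hφz : ∀ k, φ (z k) ≠ 0 := fun k => by
    simp only [z, map_unitDir, hφp]
    exact div_ne_zero (mul_ne_zero (ht k).ne' hv) (norm_ne_zero_iff.2 (hp0 k))
  have hze : ∀ k, z k ≠ e := fun k h => hφz k (by rw [h, hφe])
  have hzlim : Tendsto z atTop (𝓝 e) := by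
    have := (hplim.norm.inv₀ (norm_ne_zero_iff.2 he0)).smul hplim
    simpa [he1, z, unitDir] using this
  obtain ⟨u, ψ, hψ, hu⟩ := exists_subseq_tendsto_of_norm_le_one
    (h := fun k => unitDir (e - z k)) (fun k => norm_unitDir_le _)
  have hu0 : φ u = 0 := hφ u ⟨z ∘ ψ, fun k => ⟨by simp [z, norm_unitDir (hp0 _)], hze _⟩,
    hzlim.comp hψ.tendsto_atTop, hu⟩
  have hbound : ∀ k, |φ v| ≤ 2 * ‖v‖ * |φ (unitDir (e - z k))| := fun k => by
    have hd : 0 < ‖e - z k‖ := norm_pos_iff.2 (sub_ne_zero.2 (hze k).symm)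
    have hN : 0 < ‖p k‖ := norm_pos_iff.2 (hp0 k)
    have hnorm : ‖p k‖ * ‖e - z k‖ ≤ 2 * t k * ‖v‖ := by
      have h1 : ‖p k‖ • (e - z k) = (‖p k‖ - ‖e‖) • e - t k • v := by
        simp only [z, smul_sub, norm_smul_unitDir, he1]
        simp only [p]
        module
      have h2 : |‖p k‖ - ‖e‖| ≤ t k * ‖v‖ := by
        refine (abs_norm_sub_norm_le _ _).trans ?_
        simp [p, norm_smul, abs_of_pos (ht k)]
      calc ‖p k‖ * ‖e - z k‖ = ‖‖p k‖ • (e - z k)‖ := by rw [norm_smul, norm_norm]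
        _ ≤ ‖(‖p k‖ - ‖e‖) • e‖ + ‖t k • v‖ := h1 ▸ norm_sub_le _ _
        _ ≤ 2 * t k * ‖v‖ := by
          rw [norm_smul, norm_smul, Real.norm_eq_abs, Real.norm_eq_abs, he1, abs_of_pos (ht k)]
          rw [he1] at h2
          linarith
    have hval : t k * |φ v| = ‖p k‖ * ‖e - z k‖ * |φ (unitDir (e - z k))| := by
      rw [map_unitDir, map_sub, hφe, zero_sub, abs_div, abs_neg, abs_norm]
      simp only [z, map_unitDir, hφp, abs_div, abs_mul, abs_norm, abs_of_pos (ht k)]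
      have hN' := hN.ne'
      have hd' := hd.ne'
      simp only [z] at hd'
      field_simp
    have hmul : t k * |φ v| ≤ t k * (2 * ‖v‖ * |φ (unitDir (e - z k))|) := by
      rw [hval]
      calc _ ≤ 2 * t k * ‖v‖ * |φ (unitDir (e - z k))| := by gcongr
        _ = _ := by ring
    exact le_of_mul_le_mul_left hmul (ht k)
  have hlim : Tendsto (fun k => 2 * ‖v‖ * |φ (unitDir (e - z (ψ k)))|) atTop (𝓝 0) := by
    simpa [hu0] using (((φ.continuous.tendsto u).comp hu).abs).const_mul (2 * ‖v‖)
  exact hv (abs_nonpos_iff.1 (ge_of_tendsto' hlim fun k => hbound (ψ k)))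

end UnitDir

section Isometry

variable {X E : Type*} [NormedAddCommGroup X] [NormedSpace ℝ X]
  [NormedAddCommGroup E] [NormedSpace ℝ E] {f : X → E} {y : X} {T : X →ₗ[ℝ] E}

lemma exists_tangentDirs_map_eq [FiniteDimensional ℝ X]
    (hbij : Set.BijOn f (sphere (0 : X) 1) (sphere (0 : E) 1))
    (hiso : ∀ x ∈ sphere (0 : X) 1, ∀ x' ∈ sphere (0 : X) 1, ‖f x - f x'‖ = ‖x - x'‖)
    (hy : y ∈ sphere (0 : X) 1) (hT : RepTangent f y T) {e : E}
    (he : e ∈ tangentDirs (f y)) : ∃ u ∈ tangentDirs y, T u = e := by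
  obtain ⟨z', hz', hzlim', he⟩ := he
  choose z hz hfz using fun k => hbij.surjOn (hz' k).1
  have hzy : ∀ k, z k ≠ y := fun k h => (hz' k).2 (by rw [← hfz, h])
  have hzlim : Tendsto z atTop (𝓝 y) := by
    rw [tendsto_iff_norm_sub_tendsto_zero] at hzlim' ⊢
    simpa only [← hfz, hiso _ (hz _) _ hy] using hzlim'
  obtain ⟨u, ψ, hψ, hu⟩ := exists_subseq_tendsto_of_norm_le_one
    (h := fun k => unitDir (y - z k)) (fun k => norm_unitDir_le _)
  have hlim := hzlim.comp hψ.tendsto_atTop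
  refine ⟨u, ⟨z ∘ ψ, fun k => ⟨hz _, hzy _⟩, hlim, hu⟩, ?_⟩
  refine tendsto_nhds_unique (hT (z ∘ ψ) u (fun k => ⟨hz _, hzy _⟩) hlim hu) ?_
  simpa only [Function.comp_def, hfz] using he.comp hψ.tendsto_atTop

/-- The unique support functionals of corresponding chords from `y` and `f y` agree along the
tangent action. -/
lemma suppFn_apply_eq_of_repTangent [FiniteDimensional ℝ X] [FiniteDimensional ℝ E]
    (hiso : ∀ x ∈ sphere (0 : X) 1, ∀ x' ∈ sphere (0 : X) 1, ‖f x - f x'‖ = ‖x - x'‖)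
    (hy : y ∈ sphere (0 : X) 1) (hT : RepTangent f y T)
    {x : X} (hx : x ∈ sphere (0 : X) 1) (hxy : x ≠ y)
    {g : X →L[ℝ] ℝ} (hg : suppFn X (unitDir (x - y)) = {g})
    {g' : E →L[ℝ] ℝ} (hg' : suppFn E (unitDir (f x - f y)) = {g'})
    {u : X} (hu : u ∈ tangentDirs y) : g u = g' (T u) := by
  obtain ⟨z, hz, hzlim, hu⟩ := hu
  have hfxy : f x - f y ≠ 0 := by
    rw [← norm_ne_zero_iff, hiso _ hx _ hy]
    exact norm_ne_zero_iff.2 (sub_ne_zero.2 hxy)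
  have hv : Tendsto (fun k => y - z k) atTop (𝓝 0) := by
    simpa using hzlim.const_sub y
  have hv' : Tendsto (fun k => f y - f (z k)) atTop (𝓝 0) := by
    rw [tendsto_zero_iff_norm_tendsto_zero] at hv ⊢
    simpa only [hiso _ hy _ (hz _).1] using hv
  have h1 := tendsto_norm_add_sub_div (sub_ne_zero.2 hxy) hg hv hu
  have h2 := tendsto_norm_add_sub_div hfxy hg' hv'
    (hT z u hz hzlim hu)
  simp only [sub_add_sub_cancel, hiso _ hx _ (hz _).1, hiso _ hx _ hy,
    hiso _ hy _ (hz _).1] at h2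
  simp only [sub_add_sub_cancel] at h1
  exact tendsto_nhds_unique h1 h2

end Isometry

/-- **Lemma 6.** Let `(x_n)` be a sequence in `W_y` with `x_n → -y` such that the support
functionals `γ((x_n - y)/‖x_n - y‖)` converge to some `y* ∈ ℷ(-y)`. Then the support
functionals `γ((f x_n - f y)/‖f x_n - f y‖)` converge to some `e*`, and
`⟨y*, u⟩ = ⟨e*, T u⟩` for every tangent direction `u ∈ Λ_y`. -/
theorem lemma6 {X E : Type*} [NormedAddCommGroup X] [NormedSpace ℝ X]
    [FiniteDimensional ℝ X] [NormedAddCommGroup E] [NormedSpace ℝ E] [FiniteDimensional ℝ E]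
    (f : X → E) (hbij : Set.BijOn f (sphere (0 : X) 1) (sphere (0 : E) 1))
    (hiso : ∀ x ∈ sphere (0 : X) 1, ∀ x' ∈ sphere (0 : X) 1, ‖f x - f x'‖ = ‖x - x'‖)
    (y : X) (hy : y ∈ sphere (0 : X) 1)
    (T : X →ₗ[ℝ] E) (hT : RepTangent f y T)
    (xn : ℕ → X) (hxn : ∀ n, xn n ∈ Wset f y) (hlim : Tendsto xn atTop (𝓝 (-y)))
    (gX : ℕ → X →L[ℝ] ℝ) (hgX : ∀ n, suppFn X (unitDir (xn n - y)) = {gX n})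
    (gE : ℕ → E →L[ℝ] ℝ) (hgE : ∀ n, suppFn E (unitDir (f (xn n) - f y)) = {gE n})
    (ystar : X →L[ℝ] ℝ) (hystar : ystar ∈ suppFn X (-y))
    (hgXlim : Tendsto gX atTop (𝓝 ystar)) :
    ∃ estar : E →L[ℝ] ℝ, Tendsto gE atTop (𝓝 estar) ∧
      ∀ u ∈ tangentDirs y, ystar u = estar (T u) := by
  have hy1 : ‖y‖ = 1 := by simpa using hy
  have hfy : f y ∈ sphere (0 : E) 1 := hbij.mapsTo hy
  have hxS : ∀ n, xn n ∈ sphere (0 : X) 1 := fun n => (hxn n).1.1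
  have hxy : ∀ n, xn n ≠ y := fun n h => by
    have h2 := (hxn n).1.2
    rw [h, ← two_smul ℝ y, norm_smul, hy1] at h2
    norm_num at h2
  have hfxy : ∀ n, f (xn n) - f y ≠ 0 := fun n =>
    sub_ne_zero.2 fun h => hxy n (hbij.injOn (hxS n) hy h)
  have hgE' : ∀ n, ‖gE n‖ ≤ 1 ∧ gE n (f (xn n) - f y) = ‖f (xn n) - f y‖ := fun n =>
    (mem_suppFn_unitDir (hfxy n)).1 (hgE n ▸ mem_singleton _)
  have habs : ∀ n, ∀ e ∈ sphere (0 : E) 1, |gE n e| ≤ 1 := fun n e he => by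
    have := (gE n).le_of_opNorm_le (hgE' n).1 e
    rwa [mem_sphere_zero_iff_norm.1 he, one_mul] at this
  have hgEy : Tendsto (fun n => gE n (f y)) atTop (𝓝 (-1)) := by
    have hdist : Tendsto (fun n => 1 - ‖xn n - y‖) atTop (𝓝 (-1)) := by
      have h1 := ((hlim.sub_const y).norm).const_sub 1
      have h2 : ‖-y - y‖ = 2 := by
        rw [← neg_add', norm_neg, ← two_smul ℝ y, norm_smul, hy1]
        norm_num
      rw [h2] at h1
      norm_num at h1
      exact h1
    refine tendsto_of_tendsto_of_tendsto_of_le_of_le tendsto_const_nhds hdist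
      (fun n => (abs_le.1 (habs n _ hfy)).1) (fun n => ?_)
    have h1 := (hgE' n).2
    rw [map_sub, hiso _ (hxS n) _ hy] at h1
    have h2 := (abs_le.1 (habs n _ (hbij.mapsTo (hxS n)))).2
    change gE n (f y) ≤ 1 - ‖xn n - y‖
    linarith
  have hgET : ∀ u ∈ tangentDirs y, Tendsto (fun n => gE n (T u)) atTop (𝓝 (ystar u)) :=
    fun u hu => by
      have h := tendsto_clm_apply hgXlim (tendsto_const_nhds (x := u))
      simpa only [suppFn_apply_eq_of_repTangent hiso hy hT (hxS _) (hxy _) (hgX _) (hgE _) hu]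
        using h
  have hcluster : ∀ {a : E →L[ℝ] ℝ} {ns : ℕ → ℕ}, Tendsto ns atTop atTop →
      Tendsto (fun n => gE (ns n)) atTop (𝓝 a) →
      a (f y) = -1 ∧ ∀ u ∈ tangentDirs y, ystar u = a (T u) := fun hns ha =>
    ⟨tendsto_nhds_unique (tendsto_clm_apply ha tendsto_const_nhds) (hgEy.comp hns), fun u hu =>
      tendsto_nhds_unique ((hgET u hu).comp hns) (tendsto_clm_apply ha tendsto_const_nhds)⟩
  obtain ⟨a, φ, hφ, ha⟩ := exists_subseq_tendsto_of_norm_le_one fun n => (hgE' n).1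
  obtain ⟨hay, haT⟩ := hcluster hφ.tendsto_atTop ha
  refine ⟨a, tendsto_of_subseq_tendsto fun ns hns => ?_, haT⟩
  obtain ⟨b, ψ, hψ, hb⟩ := exists_subseq_tendsto_of_norm_le_one
    (h := gE ∘ ns) fun n => (hgE' _).1
  obtain ⟨hby, hbT⟩ := hcluster (hns.comp hψ.tendsto_atTop) hb
  have hba : b - a = 0 := by
    refine eq_zero_of_forall_tangentDirs hfy (by simp [hay, hby]) fun e he => ?_
    obtain ⟨u, hu, rfl⟩ := exists_tangentDirs_map_eq hbij hiso hy hT he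
    simp [← haT u hu, ← hbT u hu]
  exact ⟨ψ, sub_eq_zero.1 hba ▸ hb⟩
end
end

section
/- Let X and E be finite-dimensional real normed spaces and f : S_X → S_E a bijective isometry, let y ∈ S_X, and let T be a linear map representing the tangent action of f at y. Then there exists a linear isomorphism G from span ℷ(y) onto span ℷ(f(y)) such that G(ℷ(y)) = ℷ(f(y)) and ⟨y*, u⟩ = ⟨G(y*), T(u)⟩ for all y* ∈ span ℷ(y) and all u ∈ span Λ_y. In particular, dim span ℷ(y) = dim span ℷ(f(y)). -/
open Filter Topology Metric Set MeasureTheory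

noncomputable section

/-- Let `φ` be nonexpansive on the unit sphere with `[x, φ x]` contained in the sphere. Then the
norm grows at most quadratically when moving from `q` away from `φ q`. -/
theorem norm_add_smul_sub_le {X : Type*} [NormedAddCommGroup X] [NormedSpace ℝ X]
    {φ : X → X} (hφS : ∀ x ∈ sphere (0 : X) 1, φ x ∈ sphere (0 : X) 1)
    (hφL : ∀ x ∈ sphere (0 : X) 1, ∀ x' ∈ sphere (0 : X) 1, ‖φ x - φ x'‖ ≤ ‖x - x'‖)
    (hφ2 : ∀ x ∈ sphere (0 : X) 1, ‖x + φ x‖ = 2)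
    {q : X} (hq : q ∈ sphere (0 : X) 1) {t : ℝ} (ht : 0 < t) (ht1 : t < 1 / 4) :
    ∃ z ∈ sphere (0 : X) 1, ‖z - (q + t • (q - φ q))‖ ≤ 4 * t ^ 2 := by
  have hq1 : ‖q‖ = 1 := by simpa using hq
  have hq1' : ‖φ q‖ = 1 := by simpa using hφS q hq
  set d := q - φ q with hd
  have hd2 : ‖d‖ ≤ 2 := by
    calc ‖d‖ ≤ ‖q‖ + ‖φ q‖ := norm_sub_le _ _
      _ = 2 := by rw [hq1, hq1']; norm_num
  set p := q + t • d with hp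
  have htd : ‖t • d‖ = t * ‖d‖ := by rw [norm_smul, Real.norm_of_nonneg ht.le]
  have hNle : ‖p‖ ≤ 1 + t * ‖d‖ := by
    calc ‖p‖ ≤ ‖q‖ + ‖t • d‖ := norm_add_le _ _
      _ = _ := by rw [hq1, htd]
  have hNge : 1 ≤ ‖p‖ := by
    have h1 : p + t • φ q = (1 + t) • q := by
      rw [hp, hd]; module
    have h2 : ‖p + t • φ q‖ = 1 + t := by
      rw [h1, norm_smul, hq1, Real.norm_of_nonneg (by linarith), mul_one]
    have h3 := norm_add_le p (t • φ q)
    rw [h2, norm_smul, hq1', Real.norm_of_nonneg ht.le] at h3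
    linarith
  have hN0 : 0 < ‖p‖ := by linarith
  set z := ‖p‖⁻¹ • p with hz
  have hz1 : ‖z‖ = 1 := by
    rw [hz, norm_smul, norm_inv, norm_norm, inv_mul_cancel₀ hN0.ne']
  have hzS : z ∈ sphere (0 : X) 1 := by simpa using hz1
  have hzp : ‖z - p‖ = ‖p‖ - 1 := by
    have : z - p = (‖p‖⁻¹ - 1) • p := by rw [hz]; module
    rw [this, norm_smul, Real.norm_of_nonpos]
    · field_simp; ring
    · have := inv_le_one_of_one_le₀ hNge
      linarith
  have hzq : ‖z - q‖ ≤ 2 * (t * ‖d‖) := by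
    have : z - q = (z - p) + t • d := by rw [hp]; module
    rw [this]
    calc ‖(z - p) + t • d‖ ≤ ‖z - p‖ + ‖t • d‖ := norm_add_le _ _
      _ ≤ _ := by rw [hzp, htd]; linarith
  have hφz : ‖φ z‖ = 1 := by simpa using hφS z hzS
  have hzz : z + φ z ≠ 0 := by
    intro h
    have := hφ2 z hzS
    rw [h, norm_zero] at this
    norm_num at this
  obtain ⟨g, hg1, hg⟩ := exists_dual_vector ℝ (z + φ z) (norm_ne_zero_iff.2 hzz)
  have hgle : ∀ x, g x ≤ ‖x‖ := fun x => by
    have := g.le_opNorm x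
    rw [hg1, one_mul] at this
    exact (le_abs_self _).trans this
  have hg' : g z + g (φ z) = 2 := by
    rw [← map_add, hg, hφ2 z hzS]; norm_num
  have e1 := hgle z
  have e2 := hgle (φ z)
  rw [hz1] at e1
  rw [hφz] at e2
  have hgz : g z = 1 := by linarith
  have hgp : g p = ‖p‖ := by
    have : g z = ‖p‖⁻¹ * g p := by rw [hz, map_smul, smul_eq_mul]
    rw [hgz] at this
    field_simp at this
    linarith
  have e3 := hgle q
  rw [hq1] at e3
  have e4 : g (φ z) - g (φ q) ≤ 2 * (t * ‖d‖) := by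
    rw [← map_sub]
    exact (hgle _).trans ((hφL z hzS q hq).trans hzq)
  have e5 : g p = (1 + t) * g q - t * g (φ q) := by
    rw [hp, hd]; simp only [map_add, map_smul, map_sub, smul_eq_mul]; ring
  refine ⟨z, hzS, ?_⟩
  rw [hzp]
  have e6 : 1 - 2 * (t * ‖d‖) ≤ g (φ q) := by linarith
  have e7 : t * (1 - 2 * (t * ‖d‖)) ≤ t * g (φ q) := mul_le_mul_of_nonneg_left e6 ht.le
  have e8 : (1 + t) * g q ≤ (1 + t) * 1 := mul_le_mul_of_nonneg_left e3 (by linarith)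
  have e9 : t ^ 2 * ‖d‖ ≤ t ^ 2 * 2 := mul_le_mul_of_nonneg_left hd2 (by positivity)
  nlinarith

/-- A nonexpansive self-map `φ` of the unit sphere of a finite-dimensional space such that every
segment `[x, φ x]` lies in the sphere is the identity. -/
theorem eq_self_of_norm_add_eq_two {X : Type*} [NormedAddCommGroup X] [NormedSpace ℝ X]
    [FiniteDimensional ℝ X]
    {φ : X → X} (hφS : ∀ x ∈ sphere (0 : X) 1, φ x ∈ sphere (0 : X) 1)
    (hφL : ∀ x ∈ sphere (0 : X) 1, ∀ x' ∈ sphere (0 : X) 1, ‖φ x - φ x'‖ ≤ ‖x - x'‖)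
    (hφ2 : ∀ x ∈ sphere (0 : X) 1, ‖x + φ x‖ = 2)
    {x : X} (hx : x ∈ sphere (0 : X) 1) : φ x = x := by
  have hK : IsCompact (sphere (0 : X) 1) := isCompact_sphere 0 1
  have hφc : ContinuousOn φ (sphere (0 : X) 1) := by
    have : LipschitzOnWith 1 φ (sphere (0 : X) 1) :=
      LipschitzOnWith.of_dist_le_mul fun a ha b hb => by
        simpa [dist_eq_norm] using hφL a ha b hb
    exact this.continuousOn
  obtain ⟨x₀, hx₀, hmax⟩ := hK.exists_isMaxOn ⟨x, hx⟩
    ((hφc.sub continuousOn_id).norm)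
  replace hmax : ∀ z ∈ sphere (0 : X) 1, ‖φ z - z‖ ≤ ‖φ x₀ - x₀‖ := fun z hz => hmax hz
  set M := ‖φ x₀ - x₀‖ with hM
  rcases (norm_nonneg (φ x₀ - x₀)).eq_or_lt with h0 | hMpos
  · have := hmax x hx
    rw [hM, ← h0] at this
    exact sub_eq_zero.1 (norm_le_zero_iff.1 this)
  exfalso
  rw [← hM] at hMpos
  obtain ⟨g, hg1, hg⟩ := exists_dual_vector ℝ (φ x₀ - x₀) hMpos.ne'
  replace hg : g (φ x₀ - x₀) = M := by rw [hg]; rfl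
  have hgle : ∀ x, |g x| ≤ ‖x‖ := fun x => by
    have := g.le_opNorm x
    rwa [hg1, one_mul] at this
  set k := 3 / M with hk
  have hkpos : 0 < k := by positivity
  set δ := M / 2 * Real.exp (-k) with hδ
  have hδpos : 0 < δ := by positivity
  obtain ⟨w, hw, hwmax⟩ := hK.exists_isMaxOn ⟨x, hx⟩
    (f := fun z => g (φ z - z) + δ * Real.exp (-k * g z)) (by fun_prop)
  replace hwmax : ∀ z ∈ sphere (0 : X) 1, g (φ z - z) + δ * Real.exp (-k * g z)
    ≤ g (φ w - w) + δ * Real.exp (-k * g w) := fun z hz => hwmax hz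
  set r := δ * Real.exp (-k * g w) with hr
  have hrpos : 0 < r := by positivity
  have hrle : r ≤ M / 2 := by
    have h1 : -1 ≤ g w := by
      have := neg_le_of_abs_le (hgle w)
      rw [show ‖w‖ = 1 by simpa using hw] at this
      exact this
    have h2 : Real.exp (-k + -k * g w) ≤ 1 := Real.exp_le_one_iff.2 (by nlinarith)
    rw [hr, hδ, mul_assoc, ← Real.exp_add]
    calc M / 2 * Real.exp (-k + -k * g w) ≤ M / 2 * 1 := by gcongr
      _ = M / 2 := mul_one _
  have hV : M - r < g (φ w - w) := by
    have := hwmax x₀ hx₀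
    rw [hg] at this
    have h3 : 0 < δ * Real.exp (-k * g x₀) := by positivity
    linarith
  have key : ∀ z ∈ sphere (0 : X) 1, (1 + k * r) * g (w - z) ≤ ‖z - w‖ := by
    intro z hz
    have h1 := hwmax z hz
    have h2 : r * (1 - k * g (z - w)) ≤ δ * Real.exp (-k * g z) := by
      have h3 : -k * g z = -k * g w + -k * g (z - w) := by rw [map_sub]; ring
      rw [h3, Real.exp_add, ← mul_assoc, ← hr]
      have := Real.add_one_le_exp (-k * g (z - w))
      exact mul_le_mul_of_nonneg_left (by linarith) hrpos.le
    have h4 : g (φ w) - g (φ z) ≤ ‖z - w‖ := by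
      rw [← map_sub, norm_sub_rev]
      exact (le_abs_self _).trans ((hgle _).trans (hφL w hw z hz))
    simp only [map_sub] at h1 h2 ⊢
    linarith
  have hlim : (1 + k * r) * g (φ w - w) ≤ M := by
    have hT : ∀ᶠ t : ℝ in 𝓝[>] 0, (1 + k * r) * (g (φ w - w) - 4 * t) ≤ M + 4 * t := by
      filter_upwards [Ioo_mem_nhdsGT (show (0 : ℝ) < 1 / 4 by norm_num)] with t ht
      obtain ⟨z, hz, hzt⟩ := norm_add_smul_sub_le hφS hφL hφ2 hw ht.1 ht.2
      have h1 := key z hz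
      have h2 : t * g (φ w - w) - 4 * t ^ 2 ≤ g (w - z) := by
        have h3 : w - z = t • (φ w - w) - (z - (w + t • (w - φ w))) := by module
        have h3' : g (w - z) = t * g (φ w - w) - g (z - (w + t • (w - φ w))) := by
          rw [h3, map_sub, map_smul, smul_eq_mul]
        have := (le_abs_self _).trans ((hgle _).trans hzt)
        linarith
      have h4 : ‖z - w‖ ≤ 4 * t ^ 2 + t * M := by
        have h5 : z - w = (z - (w + t • (w - φ w))) + t • (w - φ w) := by module
        rw [h5]
        refine (norm_add_le _ _).trans (add_le_add hzt ?_)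
        rw [norm_smul, Real.norm_of_nonneg ht.1.le, norm_sub_rev]
        exact mul_le_mul_of_nonneg_left (hmax w hw) ht.1.le
      have h6 : (1 + k * r) * (t * g (φ w - w) - 4 * t ^ 2) ≤ 4 * t ^ 2 + t * M :=
        (mul_le_mul_of_nonneg_left h2 (by positivity)).trans (h1.trans h4)
      refine le_of_mul_le_mul_left ?_ ht.1
      linarith
    have hl : Tendsto (fun t : ℝ => (1 + k * r) * (g (φ w - w) - 4 * t)) (𝓝[>] 0)
        (𝓝 ((1 + k * r) * (g (φ w - w) - 4 * 0))) :=
      (Continuous.tendsto (by fun_prop) 0).mono_left nhdsWithin_le_nhds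
    have hr' : Tendsto (fun t : ℝ => M + 4 * t) (𝓝[>] 0) (𝓝 (M + 4 * 0)) :=
      (Continuous.tendsto (by fun_prop) 0).mono_left nhdsWithin_le_nhds
    simpa using le_of_tendsto_of_tendsto hl hr' hT
  have h5 : (1 + k * r) * (M - r) < M :=
    (mul_lt_mul_of_pos_left hV (by positivity)).trans_le hlim
  have h6 : k * M = 3 := by rw [hk]; field_simp
  have h7 : k * r ≤ 3 / 2 := by
    have := mul_le_mul_of_nonneg_left hrle hkpos.le
    linarith
  nlinarith

/-- Tingley: surjective isometries between spheres of finite-dimensional spaces are odd. -/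
theorem map_neg_of_sphere_isometry {X E : Type*} [NormedAddCommGroup X] [NormedSpace ℝ X]
    [FiniteDimensional ℝ X] [NormedAddCommGroup E] [NormedSpace ℝ E]
    {f : X → E} (hbij : Set.BijOn f (sphere (0 : X) 1) (sphere (0 : E) 1))
    (hiso : ∀ x ∈ sphere (0 : X) 1, ∀ x' ∈ sphere (0 : X) 1, ‖f x - f x'‖ = ‖x - x'‖)
    {y : X} (hy : y ∈ sphere (0 : X) 1) : f (-y) = -f y := by
  have hneg : ∀ x ∈ sphere (0 : X) 1, -x ∈ sphere (0 : X) 1 := fun x hx => by simpa using hx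
  have hex : ∀ x ∈ sphere (0 : X) 1, ∃ z ∈ sphere (0 : X) 1, f z = -f (-x) := fun x hx => by
    have : -f (-x) ∈ sphere (0 : E) 1 := by simpa using hbij.mapsTo (hneg x hx)
    exact hbij.surjOn this
  choose! φ hφS hφ using hex
  have h := eq_self_of_norm_add_eq_two hφS
    (fun x hx x' hx' => by
      rw [← hiso _ (hφS x hx) _ (hφS x' hx'), hφ x hx, hφ x' hx', neg_sub_neg, norm_sub_rev,
        hiso _ (hneg x hx) _ (hneg x' hx'), neg_sub_neg, norm_sub_rev])
    (fun x hx => by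
      have h1 : ‖f (-x)‖ = 1 := by simpa using hbij.mapsTo (hneg x hx)
      have h2 : x + φ x = φ x - (-x) := by abel
      rw [h2, ← hiso _ (hφS x hx) _ (hneg x hx), hφ x hx, ← neg_add', norm_neg, ← two_smul ℝ,
        norm_smul, h1]
      norm_num) hy
  have := hφ y hy
  rw [h] at this
  rw [this, neg_neg]

/-- The one-sided directional derivative of the norm at `y` in the direction `v`. -/
def normDir {X : Type*} [NormedAddCommGroup X] [NormedSpace ℝ X] (y v : X) : ℝ :=
  derivWithin (fun t : ℝ => ‖y + t • v‖) (Ioi 0) 0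

section normDir

variable {X : Type*} [NormedAddCommGroup X] [NormedSpace ℝ X]

theorem tendsto_normDir (y v : X) :
    Tendsto (fun t : ℝ => t⁻¹ * (‖y + t • v‖ - ‖y‖)) (𝓝[>] 0) (𝓝 (normDir y v)) := by
  have hc : ConvexOn ℝ univ (fun t : ℝ => ‖y + t • v‖) := by
    refine ⟨convex_univ, fun s _ t _ a b ha hb hab => ?_⟩
    have : y + (a • s + b • t) • v = a • (y + s • v) + b • (y + t • v) := by
      have hy : y = (a + b) • y := by rw [hab, one_smul]
      nth_rewrite 1 [hy]
      simp only [smul_eq_mul]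
      module
    simp only [this]
    refine (norm_add_le _ _).trans_eq ?_
    rw [norm_smul, norm_smul, Real.norm_of_nonneg ha, Real.norm_of_nonneg hb, smul_eq_mul,
      smul_eq_mul]
  have h := hc.hasDerivWithinAt_rightDeriv_of_mem_interior (x := 0) (by simp)
  rw [hasDerivWithinAt_iff_tendsto_slope' (by simp)] at h
  refine h.congr fun t => ?_
  simp [slope_def_module]

theorem tendsto_normDir_comp {ι : Type*} {l : Filter ι} {t : ι → ℝ} {v : ι → X} {v₀ : X} (y : X)
    (ht : Tendsto t l (𝓝[>] 0)) (hv : Tendsto v l (𝓝 v₀)) :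
    Tendsto (fun i => (t i)⁻¹ * (‖y + t i • v i‖ - ‖y‖)) l (𝓝 (normDir y v₀)) := by
  have h1 := (tendsto_normDir y v₀).comp ht
  have h2 : Tendsto (fun i => ‖v i - v₀‖) l (𝓝 0) := by
    simpa using (hv.sub_const v₀).norm
  have hpos : ∀ᶠ i in l, 0 < t i := ht.eventually self_mem_nhdsWithin
  have h3 : Tendsto (fun i => (t i)⁻¹ * (‖y + t i • v i‖ - ‖y‖)
      - (t i)⁻¹ * (‖y + t i • v₀‖ - ‖y‖)) l (𝓝 0) := by
    refine squeeze_zero_norm' ?_ h2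
    filter_upwards [hpos] with i hi
    have h4 : (t i)⁻¹ * (‖y + t i • v i‖ - ‖y‖) - (t i)⁻¹ * (‖y + t i • v₀‖ - ‖y‖)
        = (t i)⁻¹ * (‖y + t i • v i‖ - ‖y + t i • v₀‖) := by ring
    have h5 : (y + t i • v i) - (y + t i • v₀) = t i • (v i - v₀) := by module
    have h6 := abs_norm_sub_norm_le (y + t i • v i) (y + t i • v₀)
    rw [h5, norm_smul, Real.norm_of_nonneg hi.le] at h6
    rw [h4, Real.norm_eq_abs, abs_mul, abs_of_pos (inv_pos.2 hi), inv_mul_le_iff₀ hi]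
    exact h6
  simpa using h3.add h1

theorem normDir_le_norm (y v : X) : normDir y v ≤ ‖v‖ := by
  refine le_of_tendsto (tendsto_normDir y v) ?_
  filter_upwards [self_mem_nhdsWithin] with t (ht : 0 < t)
  rw [inv_mul_le_iff₀ ht]
  have := norm_add_le y (t • v)
  rw [norm_smul, Real.norm_of_nonneg ht.le] at this
  linarith

theorem normDir_zero (y : X) : normDir y 0 = 0 := by
  simp [normDir]

theorem tendsto_mul_nhdsGT_zero {c : ℝ} (hc : 0 < c) :
    Tendsto (fun t : ℝ => c * t) (𝓝[>] 0) (𝓝[>] 0) := by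
  refine tendsto_nhdsWithin_iff.2 ⟨?_, ?_⟩
  · have : Tendsto (fun t : ℝ => c * t) (𝓝 0) (𝓝 (c * 0)) := Continuous.tendsto (by fun_prop) 0
    rw [mul_zero] at this
    exact this.mono_left nhdsWithin_le_nhds
  · filter_upwards [self_mem_nhdsWithin] with t (ht : 0 < t)
    exact mul_pos hc ht

theorem normDir_smul (y v : X) {c : ℝ} (hc : 0 ≤ c) : normDir y (c • v) = c * normDir y v := by
  rcases hc.eq_or_lt with rfl | hc
  · simp [normDir_zero]
  refine tendsto_nhds_unique (tendsto_normDir y (c • v)) ?_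
  refine (((tendsto_normDir y v).comp (tendsto_mul_nhdsGT_zero hc)).const_mul c).congr fun t => ?_
  have : y + (c * t) • v = y + t • c • v := by module
  simp only [Function.comp_apply, this, mul_inv]
  field_simp

theorem normDir_add_le (y v w : X) : normDir y (v + w) ≤ normDir y v + normDir y w := by
  have h2 := tendsto_mul_nhdsGT_zero (show (0 : ℝ) < 2 by norm_num)
  refine le_of_tendsto_of_tendsto (tendsto_normDir y (v + w))
    (((tendsto_normDir y v).comp h2).add ((tendsto_normDir y w).comp h2)) ?_
  filter_upwards [self_mem_nhdsWithin] with t (ht : 0 < t)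
  simp only [Function.comp_apply]
  rw [← mul_add, inv_mul_le_iff₀ ht, mul_inv]
  have h3 : t * ((2⁻¹ * t⁻¹) * (‖y + (2 * t) • v‖ - ‖y‖ + (‖y + (2 * t) • w‖ - ‖y‖)))
      = 2⁻¹ * (‖y + (2 * t) • v‖ + ‖y + (2 * t) • w‖) - ‖y‖ := by
    field_simp
    ring
  rw [h3]
  have h4 : y + t • (v + w) = (2⁻¹ : ℝ) • ((y + (2 * t) • v) + (y + (2 * t) • w)) := by module
  have h5 := norm_add_le (y + (2 * t) • v) (y + (2 * t) • w)
  rw [h4, norm_smul, norm_inv, Real.norm_ofNat]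
  linarith

theorem normDir_smul_self {y : X} (hy : ‖y‖ = 1) (a : ℝ) : normDir y (a • y) = a := by
  refine tendsto_nhds_unique (tendsto_normDir y (a • y)) (tendsto_const_nhds.congr' ?_)
  have h : Tendsto (fun t : ℝ => 1 + t * a) (𝓝 0) (𝓝 (1 + 0 * a)) :=
    Continuous.tendsto (by fun_prop) 0
  have h' : ∀ᶠ t : ℝ in 𝓝[>] 0, 0 < 1 + t * a :=
    (h.mono_left nhdsWithin_le_nhds).eventually (lt_mem_nhds (by simp))
  filter_upwards [h', self_mem_nhdsWithin] with t ht (ht0 : 0 < t)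
  have h1 : y + t • a • y = (1 + t * a) • y := by module
  rw [h1, norm_smul, hy, Real.norm_of_nonneg ht.le]
  field_simp
  ring

theorem normDir_add_smul_self {y : X} (hy : ‖y‖ = 1) (v : X) (a : ℝ) :
    normDir y (v + a • y) = normDir y v + a := by
  have h1 := normDir_add_le y v (a • y)
  have h2 := normDir_add_le y (v + a • y) (-a • y)
  rw [normDir_smul_self hy] at h1 h2
  have h3 : v + a • y + -a • y = v := by module
  rw [h3] at h2
  linarith

theorem normDir_sub_smul_self {y : X} (hy : ‖y‖ = 1) (v : X) (a : ℝ) :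
    normDir y (v - a • y) = normDir y v - a := by
  rw [sub_eq_add_neg, ← neg_smul, normDir_add_smul_self hy, sub_eq_add_neg]

theorem normDir_neg_self {y : X} (hy : ‖y‖ = 1) : normDir y (-y) = -1 := by
  simpa using normDir_smul_self hy (-1)

theorem normDir_add_neg_nonneg (y v : X) : 0 ≤ normDir y v + normDir y (-v) := by
  have := normDir_add_le y v (-v)
  rwa [add_neg_cancel, normDir_zero] at this

theorem continuous_normDir (y : X) : Continuous (normDir y) := by
  refine (LipschitzWith.of_dist_le_mul (K := 1) fun v w => ?_).continuous
  have h1 := normDir_add_le y (v - w) w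
  have h2 := normDir_add_le y (w - v) v
  have h3 := normDir_le_norm y (v - w)
  have h4 := normDir_le_norm y (w - v)
  rw [sub_add_cancel] at h1 h2
  rw [norm_sub_rev] at h4
  rw [Real.dist_eq, dist_eq_norm, NNReal.coe_one, one_mul, abs_le]
  constructor <;> linarith

theorem mem_suppFn_iff {y : X} (hy : ‖y‖ = 1) {g : X →L[ℝ] ℝ} :
    g ∈ suppFn X y ↔ ∀ v, g v ≤ normDir y v := by
  constructor
  · rintro ⟨h1, h2⟩ v
    refine ge_of_tendsto (tendsto_normDir y v) ?_
    filter_upwards [self_mem_nhdsWithin] with t (ht : 0 < t)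
    rw [le_inv_mul_iff₀ ht]
    have h3 := (le_abs_self _).trans (g.le_opNorm (y + t • v))
    rw [h1, one_mul, map_add, map_smul, h2, smul_eq_mul] at h3
    linarith
  · intro h
    have h1 : 1 ≤ g y := by
      have := h (-y)
      rw [normDir_neg_self hy, map_neg] at this
      linarith
    have h2 : ‖g‖ ≤ 1 := by
      refine g.opNorm_le_bound zero_le_one fun v => ?_
      rw [one_mul, Real.norm_eq_abs, abs_le]
      have h3 := (h v).trans (normDir_le_norm y v)
      have h4 := (h (-v)).trans (normDir_le_norm y (-v))
      rw [map_neg, norm_neg] at h4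
      constructor <;> linarith
    have h3 := (le_abs_self _).trans (g.le_opNorm y)
    rw [hy, mul_one] at h3
    exact ⟨by linarith, by linarith⟩

theorem suppFn_nonempty {y : X} (hy : ‖y‖ = 1) : (suppFn X y).Nonempty := by
  obtain ⟨g, hg1, hg2⟩ := exists_dual_vector ℝ y (by rw [hy]; exact one_ne_zero)
  exact ⟨g, hg1, by rw [hg2, hy]; rfl⟩

/-- If the directional derivative of the norm at `y` is odd, it is the only support functional. -/
theorem eq_normDir_of_mem_suppFn {y : X} (hy : ‖y‖ = 1)
    (hlin : ∀ v, normDir y v + normDir y (-v) = 0) {g : X →L[ℝ] ℝ} (hg : g ∈ suppFn X y) (v : X) :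
    g v = normDir y v := by
  rw [mem_suppFn_iff hy] at hg
  have h1 := hg v
  have h2 := hg (-v)
  have h3 := hlin v
  rw [map_neg] at h2
  linarith

/-- At a nonsmooth point, each vector of the tangent cone is the sum of two vectors on which the
directional derivative of the norm vanishes. -/
theorem exists_add_of_normDir_nonpos {y : X} (hy : ‖y‖ = 1)
    (hnl : ∃ d, normDir y d + normDir y (-d) ≠ 0) {v : X} (hv : normDir y v ≤ 0) :
    ∃ a b, normDir y a = 0 ∧ normDir y b = 0 ∧ a + b = v := by
  have key : ∀ d, 0 < normDir y d → ∃ t : ℝ, 0 ≤ t ∧ normDir y (v + t • d) = 0 := by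
    intro d hd
    set R := normDir y (-v) / normDir y d with hR
    have hcont : Continuous fun t : ℝ => normDir y (v + t • d) :=
      (continuous_normDir y).comp (by fun_prop)
    have hR0 : 0 ≤ R := by
      have := normDir_add_neg_nonneg y v
      exact div_nonneg (by linarith) hd.le
    have hRv : 0 ≤ normDir y (v + R • d) := by
      have h1 := normDir_add_le y (v + R • d) (-v)
      have h2 : v + R • d + -v = R • d := by abel
      have h3 : R * normDir y d = normDir y (-v) := by rw [hR]; field_simp
      rw [h2, normDir_smul y d hR0, h3] at h1
      linarith
    obtain ⟨t, ht, h⟩ := intermediate_value_Icc hR0 hcont.continuousOn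
      (show (0 : ℝ) ∈ Icc _ _ from ⟨by simpa using hv, hRv⟩)
    exact ⟨t, ht.1, h⟩
  obtain ⟨d₀, hd₀⟩ := hnl
  have hd₀' : 0 < normDir y d₀ + normDir y (-d₀) :=
    lt_of_le_of_ne (normDir_add_neg_nonneg y d₀) (Ne.symm hd₀)
  set a := (normDir y d₀ - normDir y (-d₀)) / 2 with ha
  set d := d₀ - a • y with hd
  have h1 : 0 < normDir y d := by
    rw [hd, normDir_sub_smul_self hy]; linarith
  have h2 : 0 < normDir y (-d) := by
    have : -d = -d₀ + a • y := by rw [hd]; abel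
    rw [this, normDir_add_smul_self hy]; linarith
  obtain ⟨s, hs, hs'⟩ := key d h1
  obtain ⟨t, ht, ht'⟩ := key (-d) h2
  rcases (add_nonneg hs ht).eq_or_lt with h0 | hpos
  · have hs0 : s = 0 := by linarith
    rw [hs0, zero_smul, add_zero] at hs'
    exact ⟨v, 0, hs', normDir_zero y, add_zero v⟩
  · refine ⟨(t / (s + t)) • (v + s • d), (s / (s + t)) • (v + t • -d), ?_, ?_, ?_⟩
    · rw [normDir_smul _ _ (by positivity), hs', mul_zero]
    · rw [normDir_smul _ _ (by positivity), ht', mul_zero]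
    · have h3 : t / (s + t) + s / (s + t) = 1 := by field_simp; ring
      have h4 : t / (s + t) * s = s / (s + t) * t := by ring
      calc (t / (s + t)) • (v + s • d) + (s / (s + t)) • (v + t • -d)
          = (t / (s + t) + s / (s + t)) • v
            + (t / (s + t) * s - s / (s + t) * t) • d := by module
        _ = v := by rw [h3, h4, sub_self, zero_smul, one_smul, add_zero]

end normDir

section curves

variable {X E : Type*} [NormedAddCommGroup X] [NormedSpace ℝ X]
  [NormedAddCommGroup E] [NormedSpace ℝ E]

theorem unitDir_neg (v : X) : unitDir (-v) = -unitDir v := by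
  simp [unitDir]

theorem unitDir_smul {c : ℝ} (hc : 0 < c) (v : X) : unitDir (c • v) = unitDir v := by
  rw [unitDir, unitDir, norm_smul, Real.norm_of_nonneg hc.le, smul_smul]
  congr 1
  field_simp

theorem tendsto_of_tendsto_inv_smul_sub {y v : X} {z : ℕ → X} {t : ℕ → ℝ} (ht : ∀ n, 0 < t n)
    (ht0 : Tendsto t atTop (𝓝 0)) (hv : Tendsto (fun n => (t n)⁻¹ • (z n - y)) atTop (𝓝 v)) :
    Tendsto z atTop (𝓝 y) := by
  have h := (ht0.smul hv).const_add y
  rw [zero_smul, add_zero] at h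
  refine h.congr fun n => ?_
  rw [smul_inv_smul₀ (ht n).ne', add_sub_cancel]

/-- A direction tangent to the sphere is the velocity of a sequence in the sphere. -/
theorem exists_tendsto_of_normDir_eq_zero {y v : X} (hy : ‖y‖ = 1) (hv : normDir y v = 0)
    {t : ℕ → ℝ} (ht : ∀ n, 0 < t n) (ht0 : Tendsto t atTop (𝓝 0)) :
    ∃ z : ℕ → X, (∀ n, z n ∈ sphere (0 : X) 1) ∧ (v ≠ 0 → ∀ n, z n ≠ y) ∧
      Tendsto (fun n => (t n)⁻¹ • (z n - y)) atTop (𝓝 v) := by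
  have hpar : ∀ a : ℝ, v = a • y → v = 0 := by
    rintro a rfl
    rw [normDir_smul_self hy] at hv
    rw [hv, zero_smul]
  have hp : ∀ n, ‖y + t n • v‖ ≠ 0 := by
    intro n h
    have h1 : t n • v = -y := by
      rw [norm_eq_zero] at h
      exact (neg_eq_of_add_eq_zero_right h).symm
    have h2 : v = (-(t n)⁻¹) • y := by
      rw [neg_smul, ← smul_neg, ← h1, inv_smul_smul₀ (ht n).ne']
    rw [hpar _ h2, smul_zero] at h1
    rw [neg_eq_zero.1 h1.symm, norm_zero] at hy
    exact zero_ne_one hy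
  refine ⟨fun n => ‖y + t n • v‖⁻¹ • (y + t n • v), fun n => ?_, fun hv0 n hn => hv0 ?_, ?_⟩
  · rw [mem_sphere_zero_iff_norm, norm_smul, norm_inv, norm_norm, inv_mul_cancel₀ (hp n)]
  · have h1 : y + t n • v = ‖y + t n • v‖ • y := by
      have h := congrArg (fun x => ‖y + t n • v‖ • x) hn
      simpa only [smul_inv_smul₀ (hp n)] using h
    have h2 : t n • v = (‖y + t n • v‖ - 1) • y := by
      rw [sub_smul, ← h1, one_smul, add_sub_cancel_left]
    refine hpar ((t n)⁻¹ * (‖y + t n • v‖ - 1)) ?_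
    rw [mul_smul, ← h2, inv_smul_smul₀ (ht n).ne']
  · have htw : Tendsto t atTop (𝓝[>] 0) :=
      tendsto_nhdsWithin_iff.2 ⟨ht0, Eventually.of_forall ht⟩
    have h1 := (tendsto_normDir y v).comp htw
    rw [hv] at h1
    have h2 : Tendsto (fun n => y + t n • v) atTop (𝓝 y) := by
      simpa using (ht0.smul_const v).const_add y
    have h3 := h2.norm.inv₀ (by rw [hy]; exact one_ne_zero)
    have h4 := ((h3.mul h1).smul h2).const_sub v
    rw [mul_zero, zero_smul, sub_zero] at h4
    refine h4.congr fun n => ?_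
    have hn := hp n
    simp only [Function.comp_apply, hy]
    have h5 : ‖y + t n • v‖⁻¹ * ((t n)⁻¹ * (‖y + t n • v‖ - 1))
        = (t n)⁻¹ * (1 - ‖y + t n • v‖⁻¹) := by
      field_simp
    have h6 : (t n)⁻¹ * t n = 1 := inv_mul_cancel₀ (ht n).ne'
    rw [h5]
    calc v - ((t n)⁻¹ * (1 - ‖y + t n • v‖⁻¹)) • (y + t n • v)
        = v - ((t n)⁻¹ * t n) • v - (t n)⁻¹ • y
          + (t n)⁻¹ • ‖y + t n • v‖⁻¹ • (y + t n • v) := by module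
      _ = _ := by rw [h6, one_smul, sub_self, zero_sub, smul_sub]; abel

theorem normDir_eq_zero_of_tendsto {y v : X} (hy : ‖y‖ = 1) {z : ℕ → X}
    (hz : ∀ n, z n ∈ sphere (0 : X) 1) {t : ℕ → ℝ} (ht : ∀ n, 0 < t n)
    (ht0 : Tendsto t atTop (𝓝 0)) (hv : Tendsto (fun n => (t n)⁻¹ • (z n - y)) atTop (𝓝 v)) :
    normDir y v = 0 := by
  have htw : Tendsto t atTop (𝓝[>] 0) :=
    tendsto_nhdsWithin_iff.2 ⟨ht0, Eventually.of_forall ht⟩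
  refine tendsto_nhds_unique (tendsto_normDir_comp y htw hv) (tendsto_const_nhds.congr fun n => ?_)
  have h : ‖z n‖ = 1 := by simpa using hz n
  rw [smul_inv_smul₀ (ht n).ne', add_sub_cancel, h, hy, sub_self, mul_zero]

theorem normDir_neg_eq_zero_of_mem_tangentDirs {y u : X} (hy : ‖y‖ = 1)
    (hu : u ∈ tangentDirs y) : normDir y (-u) = 0 := by
  obtain ⟨z, hz, hzy, hzu⟩ := hu
  refine normDir_eq_zero_of_tendsto hy (fun n => (hz n).1) (t := fun n => ‖y - z n‖)
    (fun n => norm_pos_iff.2 (sub_ne_zero.2 (hz n).2.symm)) ?_ ?_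
  · simpa using (hzy.const_sub y).norm
  · refine hzu.neg.congr fun n => ?_
    rw [unitDir, ← smul_neg, neg_sub]

variable {f : X → E} {y : X} {T : X →ₗ[ℝ] E}

/-- A representative of the tangent action maps the velocity of a sequence in the sphere to the
velocity of its image. -/
theorem RepTangent.tendsto_inv_smul_sub (hT : RepTangent f y T)
    (hiso : ∀ x ∈ sphere (0 : X) 1, ∀ x' ∈ sphere (0 : X) 1, ‖f x - f x'‖ = ‖x - x'‖)
    (hy : y ∈ sphere (0 : X) 1) {z : ℕ → X} (hz : ∀ n, z n ∈ sphere (0 : X) 1)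
    (hzy : ∀ n, z n ≠ y) {t : ℕ → ℝ} (ht : ∀ n, 0 < t n) (ht0 : Tendsto t atTop (𝓝 0))
    {v : X} (hv0 : v ≠ 0) (hv : Tendsto (fun n => (t n)⁻¹ • (z n - y)) atTop (𝓝 v)) :
    Tendsto (fun n => (t n)⁻¹ • (f (z n) - f y)) atTop (𝓝 (T v)) := by
  have h1 : Tendsto (fun n => unitDir (y - z n)) atTop (𝓝 (-unitDir v)) := by
    have h2 := ((hv.norm.inv₀ (norm_ne_zero_iff.2 hv0)).smul hv).neg
    refine h2.congr fun n => ?_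
    change -unitDir ((t n)⁻¹ • (z n - y)) = _
    rw [unitDir_smul (inv_pos.2 (ht n)), ← unitDir_neg, neg_sub]
  have h3 := hv.norm.neg.smul
    (hT z _ (fun n => ⟨hz n, hzy n⟩) (tendsto_of_tendsto_inv_smul_sub ht ht0 hv) h1)
  have h4 : -‖v‖ • T (-unitDir v) = T v := by
    rw [← map_smul, unitDir, smul_neg, neg_smul, neg_neg, smul_inv_smul₀ (norm_ne_zero_iff.2 hv0)]
  rw [h4] at h3
  refine h3.congr fun n => ?_
  have h5 : ‖f y - f (z n)‖ = ‖z n - y‖ := by rw [hiso y hy _ (hz n), norm_sub_rev]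
  have h6 : ‖z n - y‖ ≠ 0 := norm_ne_zero_iff.2 (sub_ne_zero.2 (hzy n))
  rw [unitDir, h5, norm_smul, Real.norm_of_nonneg (inv_pos.2 (ht n)).le, smul_smul, neg_mul,
    mul_assoc, mul_inv_cancel₀ h6, mul_one, neg_smul, ← smul_neg, neg_sub]

theorem exists_velocity (hT : RepTangent f y T)
    (hiso : ∀ x ∈ sphere (0 : X) 1, ∀ x' ∈ sphere (0 : X) 1, ‖f x - f x'‖ = ‖x - x'‖)
    (hy : y ∈ sphere (0 : X) 1) {t : ℕ → ℝ} (ht : ∀ n, 0 < t n) (ht0 : Tendsto t atTop (𝓝 0))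
    {v : X} (hv : normDir y v = 0) :
    ∃ z : ℕ → X, (∀ n, z n ∈ sphere (0 : X) 1) ∧
      Tendsto (fun n => (t n)⁻¹ • (z n - y)) atTop (𝓝 v) ∧
      Tendsto (fun n => (t n)⁻¹ • (f (z n) - f y)) atTop (𝓝 (T v)) := by
  rcases eq_or_ne v 0 with rfl | hv0
  · exact ⟨fun _ => y, fun _ => hy, by simp, by simp⟩
  · obtain ⟨z, hz, hzy, hzv⟩ := exists_tendsto_of_normDir_eq_zero (by simpa using hy) hv ht ht0
    exact ⟨z, hz, hzv, hT.tendsto_inv_smul_sub hiso hy hz (hzy hv0) ht ht0 hv0 hzv⟩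

theorem add_smul_inv_smul_sub_add {F : Type*} [AddCommGroup F] [Module ℝ F] {s : ℝ}
    (hs : s ≠ 0) (p a b : F) :
    p + (2⁻¹ * s) • (s⁻¹ • (a - p) + s⁻¹ • (b - p)) = (2⁻¹ : ℝ) • (a + b) := by
  rw [← smul_add, mul_smul, smul_inv_smul₀ hs]
  module

theorem normDir_add_eq_map [FiniteDimensional ℝ X] (hT : RepTangent f y T)
    (hbij : Set.BijOn f (sphere (0 : X) 1) (sphere (0 : E) 1))
    (hiso : ∀ x ∈ sphere (0 : X) 1, ∀ x' ∈ sphere (0 : X) 1, ‖f x - f x'‖ = ‖x - x'‖)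
    (hy : y ∈ sphere (0 : X) 1) {v w : X} (hv : normDir y v = 0) (hw : normDir y w = 0) :
    normDir y (v + w) = normDir (f y) (T (v + w)) := by
  set t : ℕ → ℝ := fun n => 1 / ((n : ℝ) + 1) with htdef
  have ht : ∀ n, 0 < t n := fun n => by positivity
  have ht0 : Tendsto t atTop (𝓝 0) := tendsto_one_div_add_atTop_nhds_zero_nat
  obtain ⟨z, hz, hzv, hzT⟩ := exists_velocity hT hiso hy ht ht0 hv
  obtain ⟨z', hz', hzv', hzT'⟩ := exists_velocity hT hiso hy ht ht0 hw
  have hs : Tendsto (fun n => (2⁻¹ : ℝ) * t n) atTop (𝓝[>] 0) :=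
    (tendsto_mul_nhdsGT_zero (by norm_num)).comp
      (tendsto_nhdsWithin_iff.2 ⟨ht0, Eventually.of_forall ht⟩)
  have h1 := tendsto_normDir_comp y hs (hzv.add hzv')
  have h2 := tendsto_normDir_comp (f y) hs (hzT.add hzT')
  rw [map_add]
  refine tendsto_nhds_unique h1 (h2.congr fun n => ?_)
  have h3 : ‖f (z n) + f (z' n)‖ = ‖z n + z' n‖ := by
    have hn : -z' n ∈ sphere (0 : X) 1 := by simpa using hz' n
    have := hiso _ (hz n) _ hn
    rwa [map_neg_of_sphere_isometry hbij hiso (hz' n), sub_neg_eq_add, sub_neg_eq_add] at this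
  have hy1 : ‖y‖ = 1 := by simpa using hy
  have hfy1 : ‖f y‖ = 1 := by simpa using hbij.mapsTo hy
  rw [add_smul_inv_smul_sub_add (ht n).ne', add_smul_inv_smul_sub_add (ht n).ne', norm_smul,
    norm_smul, h3, hy1, hfy1]

theorem exists_normDir_eq_zero_map_eq [FiniteDimensional ℝ X] (hT : RepTangent f y T)
    (hbij : Set.BijOn f (sphere (0 : X) 1) (sphere (0 : E) 1))
    (hiso : ∀ x ∈ sphere (0 : X) 1, ∀ x' ∈ sphere (0 : X) 1, ‖f x - f x'‖ = ‖x - x'‖)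
    (hy : y ∈ sphere (0 : X) 1) {w : E} (hw : normDir (f y) w = 0) :
    ∃ v, normDir y v = 0 ∧ T v = w := by
  rcases eq_or_ne w 0 with rfl | hw0
  · exact ⟨0, normDir_zero y, map_zero T⟩
  set t : ℕ → ℝ := fun n => 1 / ((n : ℝ) + 1) with htdef
  have ht : ∀ n, 0 < t n := fun n => by positivity
  have ht0 : Tendsto t atTop (𝓝 0) := tendsto_one_div_add_atTop_nhds_zero_nat
  obtain ⟨p, hp, hpy, hpw⟩ := exists_tendsto_of_normDir_eq_zero
    (by simpa using hbij.mapsTo hy) hw ht ht0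
  choose z hz hzp using fun n => hbij.surjOn (hp n)
  have hnorm : ∀ n, ‖(t n)⁻¹ • (z n - y)‖ = ‖(t n)⁻¹ • (p n - f y)‖ := fun n => by
    rw [norm_smul, norm_smul, ← hiso _ (hz n) _ hy, hzp]
  obtain ⟨R, hR⟩ := hpw.norm.bddAbove_range
  obtain ⟨v, -, ψ, hψ, hv⟩ := tendsto_subseq_of_bounded
    (isBounded_closedBall (x := (0 : X)) (r := R)) (x := fun n => (t n)⁻¹ • (z n - y)) fun n => by
      rw [mem_closedBall_zero_iff, hnorm]
      exact hR ⟨n, rfl⟩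
  have htψ : Tendsto (t ∘ ψ) atTop (𝓝 0) := ht0.comp hψ.tendsto_atTop
  have hpw' := hpw.comp hψ.tendsto_atTop
  have hvw : ‖v‖ = ‖w‖ := by
    refine tendsto_nhds_unique hv.norm (hpw'.norm.congr fun n => ?_)
    exact (hnorm (ψ n)).symm
  have hv0 : v ≠ 0 := by
    rw [← norm_ne_zero_iff, hvw]
    exact norm_ne_zero_iff.2 hw0
  refine ⟨v, normDir_eq_zero_of_tendsto (by simpa using hy) (fun n => hz (ψ n))
    (fun n => ht (ψ n)) htψ hv, ?_⟩
  refine tendsto_nhds_unique (hT.tendsto_inv_smul_sub hiso hy (fun n => hz (ψ n))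
    (fun n h => hpy hw0 (ψ n) ?_) (fun n => ht (ψ n)) htψ hv0 hv) (hpw'.congr fun n => ?_)
  · rw [← hzp, h]
  · simp [hzp]

end curves

theorem bijOn_span_and_finrank_eq {V W : Type*} [AddCommGroup V] [Module ℝ V] [AddCommGroup W]
    [Module ℝ W] (G : V →ₗ[ℝ] W) {s : Set V} {t : Set W} (hst : G '' s = t)
    (hinj : Set.InjOn G (Submodule.span ℝ s : Set V)) :
    Set.BijOn G (Submodule.span ℝ s : Set V) (Submodule.span ℝ t : Set W) ∧
      Module.finrank ℝ (Submodule.span ℝ s) = Module.finrank ℝ (Submodule.span ℝ t) := by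
  have hmap : (Submodule.span ℝ s).map G = Submodule.span ℝ t := by
    rw [Submodule.map_span, hst]
  constructor
  · rw [← hmap, Submodule.map_coe]
    exact hinj.bijOn_image
  · rw [← hmap, ← LinearMap.range_domRestrict]
    refine (LinearMap.finrank_range_of_inj fun a b h => ?_).symm
    exact Subtype.ext (hinj a.2 b.2 h)

/-- **Lemma 5++.** There is a linear map `G` on dual spaces mapping `span ℷ(y)` bijectively
onto `span ℷ(f y)` with `G(ℷ(y)) = ℷ(f y)` and `⟨y*, u⟩ = ⟨G y*, T u⟩` for all
`y* ∈ span ℷ(y)` and `u ∈ span Λ_y`; in particular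
`dim span ℷ(y) = dim span ℷ(f y)`. -/
theorem lemma5plusplus {X E : Type*} [NormedAddCommGroup X] [NormedSpace ℝ X]
    [FiniteDimensional ℝ X] [NormedAddCommGroup E] [NormedSpace ℝ E] [FiniteDimensional ℝ E]
    (f : X → E) (hbij : Set.BijOn f (sphere (0 : X) 1) (sphere (0 : E) 1))
    (hiso : ∀ x ∈ sphere (0 : X) 1, ∀ x' ∈ sphere (0 : X) 1, ‖f x - f x'‖ = ‖x - x'‖)
    (y : X) (hy : y ∈ sphere (0 : X) 1)
    (T : X →ₗ[ℝ] E) (hT : RepTangent f y T) :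
    ∃ G : (X →L[ℝ] ℝ) →ₗ[ℝ] (E →L[ℝ] ℝ),
      Set.BijOn G (Submodule.span ℝ (suppFn X y) : Set (X →L[ℝ] ℝ))
        (Submodule.span ℝ (suppFn E (f y)) : Set (E →L[ℝ] ℝ)) ∧
      G '' suppFn X y = suppFn E (f y) ∧
      (∀ ystar ∈ Submodule.span ℝ (suppFn X y), ∀ u ∈ Submodule.span ℝ (tangentDirs y),
        ystar u = (G ystar) (T u)) ∧
      Module.finrank ℝ (Submodule.span ℝ (suppFn X y))
        = Module.finrank ℝ (Submodule.span ℝ (suppFn E (f y))) := by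
  have hy1 : ‖y‖ = 1 := by simpa using hy
  have hfy1 : ‖f y‖ = 1 := by simpa using hbij.mapsTo hy
  have hadd := fun {v w : X} (hv : normDir y v = 0) (hw : normDir y w = 0) =>
    normDir_add_eq_map hT hbij hiso hy hv hw
  have hlift := fun {w : E} (hw : normDir (f y) w = 0) =>
    exists_normDir_eq_zero_map_eq hT hbij hiso hy hw
  have hmap : ∀ {v : X}, normDir y v = 0 → normDir (f y) (T v) = 0 := by
    intro v hv
    have := hadd hv (normDir_zero y)
    rwa [add_zero, hv, eq_comm] at this
  by_cases hlin : ∀ v, normDir y v + normDir y (-v) = 0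
  · have hlinE : ∀ v, normDir (f y) v + normDir (f y) (-v) = 0 := by
      by_contra hnl
      push Not at hnl
      obtain ⟨a', b', ha', hb', hab'⟩ := exists_add_of_normDir_nonpos hfy1 hnl
        (v := -f y) (by rw [normDir_neg_self hfy1]; norm_num)
      obtain ⟨a, ha, rfl⟩ := hlift ha'
      obtain ⟨b, hb, rfl⟩ := hlift hb'
      have h1 := hadd ha hb
      rw [map_add, hab', normDir_neg_self hfy1] at h1
      have h2 := normDir_add_le y (-a) (-b)
      have h3 := hlin a
      have h4 := hlin b
      have h5 := hlin (a + b)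
      rw [neg_add] at h5
      linarith
    obtain ⟨g, hg⟩ := suppFn_nonempty hy1
    obtain ⟨e, he⟩ := suppFn_nonempty hfy1
    have hgs : suppFn X y = {g} := Set.eq_singleton_iff_unique_mem.2 ⟨hg, fun g' hg' => by
      ext v
      rw [eq_normDir_of_mem_suppFn hy1 hlin hg', eq_normDir_of_mem_suppFn hy1 hlin hg]⟩
    have hes : suppFn E (f y) = {e} := Set.eq_singleton_iff_unique_mem.2 ⟨he, fun e' he' => by
      ext v
      rw [eq_normDir_of_mem_suppFn hfy1 hlinE he', eq_normDir_of_mem_suppFn hfy1 hlinE he]⟩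
    let G : (X →L[ℝ] ℝ) →ₗ[ℝ] (E →L[ℝ] ℝ) :=
      { toFun := fun φ => φ y • e
        map_add' := fun φ ψ => by simp [add_smul]
        map_smul' := fun c φ => by simp [mul_smul] }
    have hG : ∀ φ, G φ = φ y • e := fun _ => rfl
    have hGg : G g = e := by rw [hG, hg.2, one_smul]
    have himg : G '' suppFn X y = suppFn E (f y) := by rw [hgs, hes, image_singleton, hGg]
    have he0 : e ≠ 0 := by
      rintro rfl
      simpa using he.2
    have hinj : Set.InjOn G (Submodule.span ℝ (suppFn X y) : Set (X →L[ℝ] ℝ)) := by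
      rw [hgs]
      intro φ hφ ψ hψ h
      obtain ⟨a, rfl⟩ := Submodule.mem_span_singleton.1 hφ
      obtain ⟨b, rfl⟩ := Submodule.mem_span_singleton.1 hψ
      rw [map_smul, map_smul, hGg] at h
      rw [smul_left_injective ℝ he0 h]
    obtain ⟨h1, h2⟩ := bijOn_span_and_finrank_eq G himg hinj
    refine ⟨G, h1, himg, fun φ hφ u hu => ?_, h2⟩
    rw [hgs] at hφ
    obtain ⟨a, rfl⟩ := Submodule.mem_span_singleton.1 hφ
    rw [map_smul, hGg]
    suffices h : g u = e (T u) by simp [h]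
    induction hu using Submodule.span_induction with
    | mem u hu =>
      have hu0 := normDir_neg_eq_zero_of_mem_tangentDirs hy1 hu
      have h3 := eq_normDir_of_mem_suppFn hy1 hlin hg (-u)
      have h4 := eq_normDir_of_mem_suppFn hfy1 hlinE he (T (-u))
      rw [hu0, map_neg] at h3
      rw [hmap hu0, map_neg, map_neg] at h4
      linarith
    | zero => simp
    | add u v _ _ hu hv => simp [hu, hv]
    | smul c u _ hu => simp [hu]
  · push Not at hlin
    have hK : ∀ v, normDir y v ≤ 0 → normDir y v = normDir (f y) (T v) := by
      intro v hv
      obtain ⟨a, b, ha, hb, rfl⟩ := exists_add_of_normDir_nonpos hy1 hlin hv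
      exact hadd ha hb
    have hnlE : ∃ d, normDir (f y) d + normDir (f y) (-d) ≠ 0 := by
      by_contra! hlinE
      obtain ⟨a, b, ha, hb, hab⟩ := exists_add_of_normDir_nonpos hy1 hlin
        (v := -y) (by rw [normDir_neg_self hy1]; norm_num)
      have h1 := hadd ha hb
      rw [map_add, hab, normDir_neg_self hy1] at h1
      have h2 := normDir_add_le (f y) (-T a) (-T b)
      have h3 := hlinE (T a)
      have h4 := hlinE (T b)
      have h5 := hlinE (T a + T b)
      rw [hmap ha] at h3
      rw [hmap hb] at h4
      rw [neg_add] at h5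
      linarith
    obtain ⟨p, hp, hpy⟩ : ∃ p, normDir y p = -1 ∧ T p = -f y := by
      obtain ⟨a', b', ha', hb', hab'⟩ := exists_add_of_normDir_nonpos hfy1 hnlE
        (v := -f y) (by rw [normDir_neg_self hfy1]; norm_num)
      obtain ⟨a, ha, rfl⟩ := hlift ha'
      obtain ⟨b, hb, rfl⟩ := hlift hb'
      refine ⟨a + b, ?_, by rw [map_add, hab']⟩
      rw [hadd ha hb, map_add, hab', normDir_neg_self hfy1]
    have hsurj : Function.Surjective T := by
      intro w
      obtain ⟨v, -, hv⟩ := hlift (w := w - normDir (f y) w • f y)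
        (by rw [normDir_sub_smul_self hfy1, sub_self])
      refine ⟨v - normDir (f y) w • p, ?_⟩
      rw [map_sub, map_smul, hv, hpy, smul_neg, sub_neg_eq_add, sub_add_cancel]
    have heq : ∀ v, normDir (f y) (T v) = normDir y v := by
      intro v
      set α := |normDir y v| with hα
      have hα0 : 0 ≤ α := abs_nonneg _
      have hvα : normDir y v ≤ α := le_abs_self _
      apply le_antisymm
      · have h1 : normDir y (v + α • p) ≤ normDir y v - α := by
          have := normDir_add_le y v (α • p)
          rw [normDir_smul y p hα0, hp] at this
          linarith
        have h2 := hK (v + α • p) (by linarith)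
        rw [map_add, map_smul, hpy, smul_neg, ← sub_eq_add_neg, normDir_sub_smul_self hfy1] at h2
        linarith
      · have h1 := hK (v - α • y) (by rw [normDir_sub_smul_self hy1]; linarith)
        have h2 := hK (-y) (by rw [normDir_neg_self hy1]; norm_num)
        have h3 := normDir_add_le (f y) (T v) (α • T (-y))
        rw [normDir_smul _ _ hα0, ← h2, normDir_neg_self hy1, ← map_smul, ← map_add, smul_neg,
          ← sub_eq_add_neg, ← h1, normDir_sub_smul_self hy1] at h3
        linarith
    let A : (E →L[ℝ] ℝ) →ₗ[ℝ] (X →L[ℝ] ℝ) :=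
      { toFun := fun e => e.comp (LinearMap.toContinuousLinearMap T)
        map_add' := fun _ _ => rfl
        map_smul' := fun _ _ => rfl }
    have hA : ∀ e v, A e v = e (T v) := fun _ _ => rfl
    have hAinj : LinearMap.ker A = ⊥ := by
      refine LinearMap.ker_eq_bot'.2 fun e he => ?_
      ext w
      obtain ⟨v, rfl⟩ := hsurj w
      rw [← hA, he]
      rfl
    have hAmem : ∀ e, A e ∈ suppFn X y ↔ e ∈ suppFn E (f y) := by
      intro e
      rw [mem_suppFn_iff hy1, mem_suppFn_iff hfy1, hsurj.forall]
      simp only [hA, heq]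
    have hArange : ∀ g ∈ suppFn X y, ∃ e, A e = g := by
      intro g hg
      rw [mem_suppFn_iff hy1] at hg
      obtain ⟨S, hS⟩ := T.exists_rightInverse_of_surjective (LinearMap.range_eq_top.2 hsurj)
      have hker : ∀ v, T v = 0 → g v ≤ 0 := fun v hv => by
        have := hg v
        rwa [← heq, hv, normDir_zero] at this
      refine ⟨LinearMap.toContinuousLinearMap ((g : X →ₗ[ℝ] ℝ) ∘ₗ S), ?_⟩
      ext v
      have hTS : T (S (T v)) = T v := LinearMap.congr_fun hS (T v)
      have h1 := hker (S (T v) - v) (by rw [map_sub, hTS, sub_self])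
      have h2 := hker (v - S (T v)) (by rw [map_sub, hTS, sub_self])
      rw [map_sub] at h1 h2
      rw [hA]
      change g (S (T v)) = g v
      linarith
    obtain ⟨G, hG⟩ := A.exists_leftInverse_of_injective hAinj
    have hGA : ∀ e, G (A e) = e := fun e => LinearMap.congr_fun hG e
    have himgA : A '' suppFn E (f y) = suppFn X y := by
      ext g
      constructor
      · rintro ⟨e, he, rfl⟩
        exact (hAmem e).2 he
      · intro hg
        obtain ⟨e, rfl⟩ := hArange g hg
        exact ⟨e, (hAmem e).1 hg, rfl⟩
    have himg : G '' suppFn X y = suppFn E (f y) := by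
      rw [← himgA, Set.image_image]
      simp only [hGA, Set.image_id']
    have hspan : ∀ g ∈ Submodule.span ℝ (suppFn X y), ∃ e, A e = g := by
      intro g hg
      rw [← himgA, ← Submodule.map_span] at hg
      obtain ⟨e, -, he⟩ := hg
      exact ⟨e, he⟩
    have hinj : Set.InjOn G (Submodule.span ℝ (suppFn X y) : Set (X →L[ℝ] ℝ)) := by
      intro g hg g' hg' h
      obtain ⟨e, rfl⟩ := hspan g hg
      obtain ⟨e', rfl⟩ := hspan g' hg'
      rw [hGA, hGA] at h
      rw [h]
    obtain ⟨h1, h2⟩ := bijOn_span_and_finrank_eq G himg hinj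
    refine ⟨G, h1, himg, fun g hg u _ => ?_, h2⟩
    obtain ⟨e, rfl⟩ := hspan g hg
    rw [hGA, hA]
end
end
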